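/- In Setup (§1): the set T₁ of ordered pairs (A,B), where A and B are finite subsets of ℕ with 0 ∉ B, neither A nor B contains two consecutive integers, |A| = N/2 + 1, |B| = N/2, A ⊔ B equals the multiset {â_0,…,â_N}, and A^− ⊔ B^− equals the multiset {a_0,…,a_N}, has exactly 2^M elements. -/

import Mathlib

/-- The shifted sequence `â_i = a_i + ⌈i/2⌉`. -/
def hatSeq (a : ℕ → ℕ) (i : ℕ) : ℕ := a i + (i + 1) / 2

/-- Positions `k` such that the value `a_{2k+1}` differs from both of its neighbours. -/
def oddSingles (n : ℕ) (a : ℕ → ℕ) : Finset ℕ :=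
  (Finset.range n).filter fun k => a (2 * k) ≠ a (2 * k + 1) ∧ a (2 * k + 1) ≠ a (2 * k + 2)

/-- Whether the `k`-th pair `(â_{2k-1}, â_{2k})` is exchanged, when the exchanges are started at the
positions in `S` and propagated along the equalities `a_{2k} = a_{2k+1}`. -/
def swapped (a : ℕ → ℕ) (S : Finset ℕ) : ℕ → Bool
  | 0 => false
  | k + 1 => decide (k ∈ S) || (decide (a (2 * k) = a (2 * k + 1)) && swapped a S k)

/-- The increasing enumeration of the first set attached to `S`. -/
def firstSeq (a : ℕ → ℕ) (S : Finset ℕ) : ℕ → ℕ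
  | 0 => hatSeq a 0
  | k + 1 => if swapped a S (k + 1) then hatSeq a (2 * k + 1) else hatSeq a (2 * k + 2)

/-- The increasing enumeration (from index `1` on) of the second set attached to `S`. -/
def secondSeq (a : ℕ → ℕ) (S : Finset ℕ) : ℕ → ℕ
  | 0 => 0
  | k + 1 => if swapped a S (k + 1) then hatSeq a (2 * k + 2) else hatSeq a (2 * k + 1)

/-- The pair of sets enumerated by `x_0, …, x_n` and `y_1, …, y_n`. -/
def pairOfSeqs (n : ℕ) (x y : ℕ → ℕ) : Finset ℕ × Finset ℕ :=
  ((Finset.range (n + 1)).image x, (Finset.range n).image fun k => y (k + 1))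

theorem hatSeq_two_mul (a : ℕ → ℕ) (k : ℕ) : hatSeq a (2 * k) = a (2 * k) + k := by
  unfold hatSeq; omega

theorem hatSeq_two_mul_add_one (a : ℕ → ℕ) (k : ℕ) :
    hatSeq a (2 * k + 1) = a (2 * k + 1) + (k + 1) := by
  unfold hatSeq; omega

theorem hatSeq_two_mul_add_two (a : ℕ → ℕ) (k : ℕ) :
    hatSeq a (2 * k + 2) = a (2 * k + 2) + (k + 1) := by
  unfold hatSeq; omega

theorem sort_image_range {m : ℕ} {x : ℕ → ℕ} (hx : ∀ i j, i < j → j < m → x i < x j) :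
    ((Finset.range m).image x).sort (· ≤ ·) = (List.range m).map x := by
  have hp : ((List.range m).map x).Pairwise (· < ·) := by
    rw [List.pairwise_map]
    refine List.Pairwise.imp_of_mem ?_ (List.pairwise_lt_range (n := m))
    intro i j _ hj hij
    exact hx i j hij (List.mem_range.1 hj)
  have hn : ((List.range m).map x).Nodup := hp.imp fun h => h.ne
  have he : (Finset.range m).image x = ((List.range m).map x).toFinset := by
    ext t; simp
  rw [he, List.toFinset_sort _ hn]
  exact hp.imp fun h => h.le

theorem image_range_val {m : ℕ} {x : ℕ → ℕ} (hx : ∀ i j, i < j → j < m → x i < x j) :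
    ((Finset.range m).image x).val = (Multiset.range m).map x := by
  rw [← Finset.sort_eq ((Finset.range m).image x) (· ≤ ·), sort_image_range hx]
  rfl

theorem card_image_range {m : ℕ} {x : ℕ → ℕ} (hx : ∀ i j, i < j → j < m → x i < x j) :
    ((Finset.range m).image x).card = m := by
  rw [Finset.card_def, image_range_val hx]; simp

theorem mapIdx_map_range (m : ℕ) (x : ℕ → ℕ) (f : ℕ → ℕ → ℕ) :
    ((List.range m).map x).mapIdx f = (List.range m).map fun k => f k (x k) := by
  apply List.ext_getElem <;> simp

theorem exists_enumeration (A : Finset ℕ) :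
    ∃ x : ℕ → ℕ, (∀ i j, i < j → j < A.card → x i < x j) ∧ A = (Finset.range A.card).image x := by
  refine ⟨fun k => (A.sort (· ≤ ·)).getD k 0, ?_, ?_⟩
  · intro i j hij hj
    have hl : (A.sort (· ≤ ·)).length = A.card := Finset.length_sort _
    have hs := Finset.sortedLT_sort A
    simp only [List.getD_eq_getElem _ _ (hl.symm ▸ hj),
      List.getD_eq_getElem _ _ (hl.symm ▸ hij.trans hj)]
    exact List.pairwise_iff_getElem.1 hs.pairwise i j _ _ hij
  · ext t
    rw [← Finset.mem_sort (· ≤ ·), List.mem_iff_getElem, Finset.mem_image]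
    have hl : (A.sort (· ≤ ·)).length = A.card := Finset.length_sort _
    constructor
    · rintro ⟨i, hi, rfl⟩
      exact ⟨i, by simpa using hl ▸ hi, by rw [List.getD_eq_getElem _ _ hi]⟩
    · rintro ⟨i, hi, rfl⟩
      have hi' : i < (A.sort (· ≤ ·)).length := by rw [hl]; simpa using hi
      exact ⟨i, hi', by rw [List.getD_eq_getElem _ _ hi']⟩

theorem lt_of_gap {m : ℕ} {x : ℕ → ℕ} (hx : ∀ k, k + 1 < m → x k + 2 ≤ x (k + 1)) :
    ∀ i j, i < j → j < m → x i + 2 ≤ x j := by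
  intro i j hij
  induction j, hij using Nat.le_induction with
  | base => exact hx i
  | succ j hij ih =>
    intro hj
    have h1 := ih (by omega)
    have h2 := hx j hj
    omega

/-- Multiset form of: a sequence obtained by exchanging the two members of some of the pairs
`(z_{2k+1}, z_{2k+2})` has the same terms. -/
theorem map_range_add_map_range {n : ℕ} {x y z : ℕ → ℕ} (h0 : x 0 = z 0)
    (h : ∀ k < n, (x (k + 1) = z (2 * k + 1) ∧ y (k + 1) = z (2 * k + 2)) ∨
      (x (k + 1) = z (2 * k + 2) ∧ y (k + 1) = z (2 * k + 1))) :
    (Multiset.range (n + 1)).map x + (Multiset.range n).map (fun k => y (k + 1)) =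
      (Multiset.range (2 * n + 1)).map z := by
  induction n with
  | zero => simp [h0]
  | succ n ih =>
    have ih' := ih fun k hk => h k (by omega)
    rw [Multiset.range_succ (n + 1), Multiset.range_succ n,
      show 2 * (n + 1) + 1 = 2 * n + 1 + 1 + 1 by ring, Multiset.range_succ (2 * n + 1 + 1),
      Multiset.range_succ (2 * n + 1)]
    rw [Multiset.range_succ n] at ih'
    simp only [Multiset.map_cons, Multiset.cons_add, Multiset.add_cons] at ih' ⊢
    rw [ih']
    rcases h n (by omega) with ⟨h1, h2⟩ | ⟨h1, h2⟩
    · rw [h1, h2]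
    · rw [h1, h2, Multiset.cons_swap]

theorem le_of_step {N : ℕ} {z : ℕ → ℕ} (hz : ∀ i, i + 1 ≤ N → z i ≤ z (i + 1)) :
    ∀ i j, i ≤ j → j ≤ N → z i ≤ z j := by
  intro i j hij
  induction j, hij using Nat.le_induction with
  | base => intro _; exact le_rfl
  | succ j hij ih => intro hj; exact (ih (by omega)).trans (hz j hj)

theorem map_Ico_eq_cons {p P : ℕ} (h : p < P) (x : ℕ → ℕ) :
    (Multiset.Ico p P).map x = x p ::ₘ (Multiset.Ico (p + 1) P).map x := by
  have : Multiset.Ico p P = p ::ₘ Multiset.Ico (p + 1) P := by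
    have := congrArg Finset.val (Finset.insert_Ico_add_one_left_eq_Ico h)
    rw [Finset.insert_val_of_notMem (by simp)] at this
    exact this.symm
  rw [this, Multiset.map_cons]

/-- If a sorted sequence is a merge of two sorted sequences, its first term is the first term of
one of them. -/
theorem merge_step {x y z : ℕ → ℕ} {p P q Q r R : ℕ}
    (hx : ∀ i j, i ≤ j → j < P → x i ≤ x j) (hy : ∀ i j, i ≤ j → j < Q → y i ≤ y j)
    (hz : ∀ i j, i ≤ j → j < R → z i ≤ z j) (hr : r < R)
    (h : (Multiset.Ico p P).map x + (Multiset.Ico q Q).map y = (Multiset.Ico r R).map z) :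
    (p < P ∧ x p = z r ∧
      (Multiset.Ico (p + 1) P).map x + (Multiset.Ico q Q).map y =
        (Multiset.Ico (r + 1) R).map z) ∨
    (q < Q ∧ y q = z r ∧
      (Multiset.Ico p P).map x + (Multiset.Ico (q + 1) Q).map y =
        (Multiset.Ico (r + 1) R).map z) := by
  have hmem : ∀ t, (t ∈ (Multiset.Ico p P).map x ∨ t ∈ (Multiset.Ico q Q).map y) ↔
      t ∈ (Multiset.Ico r R).map z := by
    intro t; rw [← h, Multiset.mem_add]
  simp only [Multiset.mem_map, Multiset.mem_Ico] at hmem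
  rcases (hmem (z r)).2 ⟨r, ⟨le_rfl, hr⟩, rfl⟩ with ⟨j, ⟨hj1, hj2⟩, hj⟩ | ⟨j, ⟨hj1, hj2⟩, hj⟩
  · left
    have hp : p < P := by omega
    obtain ⟨i, ⟨hi1, hi2⟩, hi⟩ := (hmem (x p)).1 (Or.inl ⟨p, ⟨le_rfl, hp⟩, rfl⟩)
    have e : x p = z r := by
      have := hx p j hj1 hj2
      have := hz r i hi1 hi2
      omega
    refine ⟨hp, e, ?_⟩
    rw [map_Ico_eq_cons hp, map_Ico_eq_cons hr, e, Multiset.cons_add] at h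
    exact (Multiset.cons_inj_right _).1 h
  · right
    have hq : q < Q := by omega
    obtain ⟨i, ⟨hi1, hi2⟩, hi⟩ := (hmem (y q)).1 (Or.inr ⟨q, ⟨le_rfl, hq⟩, rfl⟩)
    have e : y q = z r := by
      have := hy q j hj1 hj2
      have := hz r i hi1 hi2
      omega
    refine ⟨hq, e, ?_⟩
    rw [map_Ico_eq_cons hq, map_Ico_eq_cons hr, e, Multiset.add_cons] at h
    exact (Multiset.cons_inj_right _).1 h

/-- The rigidity statement: in an admissible pair of sequences, each pair `(â_{2k+1}, â_{2k+2})` is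
split between the two sequences. -/
theorem split_pairs {n : ℕ} {a x y : ℕ → ℕ}
    (hmono : ∀ i, i + 1 ≤ 2 * n → a i ≤ a (i + 1))
    (hx : ∀ k, k < n → x k + 2 ≤ x (k + 1))
    (hy : ∀ k, k + 1 < n → y (k + 1) + 2 ≤ y (k + 2))
    (hy0 : 0 < n → 0 < y 1)
    (hxa : ∀ k ≤ n, ∃ i ≤ 2 * n, a i = x k - k)
    (hya : ∀ k < n, ∃ i ≤ 2 * n, a i = y (k + 1) - (k + 1))
    (h : (Multiset.range (n + 1)).map x + (Multiset.range n).map (fun k => y (k + 1)) =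
      (Multiset.range (2 * n + 1)).map (hatSeq a)) :
    x 0 = hatSeq a 0 ∧ ∀ k < n,
      (x (k + 1) = hatSeq a (2 * k + 1) ∧ y (k + 1) = hatSeq a (2 * k + 2)) ∨
      (x (k + 1) = hatSeq a (2 * k + 2) ∧ y (k + 1) = hatSeq a (2 * k + 1)) := by
  have ha := le_of_step hmono
  have hno : ∀ k < n, a (2 * k + 1) + 2 ≤ a (2 * k + 2) →
      ∀ i ≤ 2 * n, a i ≠ a (2 * k + 2) - 1 := by
    intro k hk hlt i hi e
    rcases Nat.lt_or_ge (2 * k + 1) i with h1 | h1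
    · have := ha (2 * k + 2) i h1 hi
      omega
    · have := ha i (2 * k + 1) h1 (by omega)
      omega
  have hz : ∀ i j, i ≤ j → j < 2 * n + 1 → hatSeq a i ≤ hatSeq a j := by
    intro i j hij hj
    have := ha i j hij (by omega)
    unfold hatSeq
    omega
  have hx' : ∀ i j, i ≤ j → j < n + 1 → x i ≤ x j := by
    intro i j hij hj
    rcases hij.eq_or_lt with rfl | hij
    · rfl
    · have := lt_of_gap (m := n + 1) (fun k hk => hx k (by omega)) i j hij hj
      omega
  have hy' : ∀ i j, i ≤ j → j < n → y (i + 1) ≤ y (j + 1) := by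
    intro i j hij hj
    rcases hij.eq_or_lt with rfl | hij
    · rfl
    · have := lt_of_gap (x := fun k => y (k + 1)) hy i j hij hj
      omega
  have key : ∀ k ≤ n, (x 0 = hatSeq a 0 ∧ ∀ k' < k,
      (x (k' + 1) = hatSeq a (2 * k' + 1) ∧ y (k' + 1) = hatSeq a (2 * k' + 2)) ∨
      (x (k' + 1) = hatSeq a (2 * k' + 2) ∧ y (k' + 1) = hatSeq a (2 * k' + 1))) ∧
      (Multiset.Ico (k + 1) (n + 1)).map x + (Multiset.Ico k n).map (fun k => y (k + 1)) =
        (Multiset.Ico (2 * k + 1) (2 * n + 1)).map (hatSeq a) := by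
    intro k
    induction k with
    | zero =>
      intro _
      have hr : ∀ m, Multiset.range m = Multiset.Ico 0 m := fun m => by
        have := congrArg Finset.val ((Finset.range_eq_Ico m))
        exact this
      rw [hr, hr, hr] at h
      rcases merge_step hx' hy' hz (by omega) h with ⟨_, h1, h2⟩ | ⟨h0, h1, h2⟩
      · exact ⟨⟨h1, by simp⟩, h2⟩
      · exfalso
        obtain ⟨i, hi, e⟩ := hya 0 h0
        have := ha 0 i (by omega) hi
        have := hy0 h0
        have := hatSeq_two_mul a 0
        simp only [Nat.mul_zero, Nat.zero_add] at *
        omega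
    | succ k ih =>
      intro hk
      obtain ⟨⟨h0, hsplit⟩, hrest⟩ := ih (by omega)
      have e1 := hatSeq_two_mul_add_one a k
      have e2 := hatSeq_two_mul_add_two a k
      have hbad := hno k (by omega)
      have conclude : ((x (k + 1) = hatSeq a (2 * k + 1) ∧ y (k + 1) = hatSeq a (2 * k + 2)) ∨
          (x (k + 1) = hatSeq a (2 * k + 2) ∧ y (k + 1) = hatSeq a (2 * k + 1))) ∧
          (Multiset.Ico (k + 1 + 1) (n + 1)).map x +
            (Multiset.Ico (k + 1) n).map (fun k => y (k + 1)) =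
            (Multiset.Ico (2 * k + 1 + 1 + 1) (2 * n + 1)).map (hatSeq a) := by
        rcases merge_step hx' hy' hz (by omega) hrest with ⟨h1, h2, h3⟩ | ⟨h1, h2, h3⟩
        · rcases merge_step hx' hy' hz (by omega) h3 with ⟨g1, g2, g3⟩ | ⟨g1, g2, g3⟩
          · exfalso
            have g2' : x (k + 2) = hatSeq a (2 * k + 2) := g2
            have hgap : x (k + 1) + 2 ≤ x (k + 2) := hx (k + 1) (by omega)
            obtain ⟨i, hi, e⟩ := hxa (k + 2) (by omega)
            exact hbad (by omega) i hi (by omega)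
          · exact ⟨Or.inl ⟨h2, g2⟩, g3⟩
        · rcases merge_step hx' hy' hz (by omega) h3 with ⟨g1, g2, g3⟩ | ⟨g1, g2, g3⟩
          · exact ⟨Or.inr ⟨g2, h2⟩, g3⟩
          · exfalso
            have g2' : y (k + 2) = hatSeq a (2 * k + 2) := g2
            have hgap : y (k + 1) + 2 ≤ y (k + 2) := hy k (by omega)
            obtain ⟨i, hi, e⟩ := hya (k + 1) (by omega)
            change a i = y (k + 2) - (k + 2) at e
            exact hbad (by omega) i hi (by omega)
      refine ⟨⟨h0, ?_⟩, ?_⟩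
      · intro k' hk'
        rcases Nat.lt_succ_iff_lt_or_eq.1 hk' with h | rfl
        · exact hsplit k' h
        · exact conclude.1
      · exact conclude.2
  exact (key n le_rfl).1

theorem card_filter_eq_one_iff {N : ℕ} {a : ℕ → ℕ}
    (hmono : ∀ i, i + 1 ≤ N → a i ≤ a (i + 1)) {i : ℕ} (hi : i ≤ N) :
    ((Finset.range (N + 1)).filter fun j => a j = a i).card = 1 ↔
      ¬ (i < N ∧ a i = a (i + 1)) ∧ ¬ (0 < i ∧ a (i - 1) = a i) := by
  have ha := le_of_step hmono
  rw [Finset.card_eq_one]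
  constructor
  · rintro ⟨t, ht⟩
    have hm : ∀ j, j ≤ N → a j = a i → j = t := by
      intro j hj e
      rw [← Finset.mem_singleton, ← ht]
      simp [e, Nat.lt_succ_of_le hj]
    have h1 := hm i hi rfl
    constructor
    · rintro ⟨h2, h3⟩
      have := hm (i + 1) h2 h3.symm
      omega
    · rintro ⟨h2, h3⟩
      have := hm (i - 1) (by omega) h3
      omega
  · rintro ⟨h1, h2⟩
    refine ⟨i, ?_⟩
    ext j
    simp only [Finset.mem_filter, Finset.mem_range, Finset.mem_singleton]
    constructor
    · rintro ⟨hj, e⟩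
      by_contra hne
      rcases Nat.lt_or_gt_of_ne hne with h | h
      · have g1 := ha j (i - 1) (by omega) (by omega)
        have g2 := ha (i - 1) i (by omega) (by omega)
        exact h2 ⟨by omega, by omega⟩
      · have g1 := ha (i + 1) j (by omega) (by omega)
        have g2 := ha i (i + 1) (by omega) (by omega)
        exact h1 ⟨by omega, by omega⟩
    · rintro rfl
      exact ⟨by omega, rfl⟩

theorem card_singles {n : ℕ} {a : ℕ → ℕ}
    (hmono : ∀ i, i + 1 ≤ 2 * n → a i ≤ a (i + 1))
    (hstrict : ∀ i, i + 2 ≤ 2 * n → a i < a (i + 2)) :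
    ((Finset.range (2 * n + 1)).filter fun i =>
      ((Finset.range (2 * n + 1)).filter fun j => a j = a i).card = 1).card =
      2 * (oddSingles n a).card + 1 := by
  let p : ℕ → ℕ := fun i => if a i = a (i + 1) then 1 else 0
  have h1 : ∑ i ∈ Finset.range (2 * n + 1),
      ((if ((Finset.range (2 * n + 1)).filter fun j => a j = a i).card = 1 then 1 else 0) +
        (if i < 2 * n then p i else 0) + (if 0 < i then p (i - 1) else 0)) = 2 * n + 1 := by
    rw [Finset.sum_congr rfl (g := fun _ => 1)]
    · simp
    · intro i hi
      have hi' : i ≤ 2 * n := by simpa [Nat.lt_succ_iff] using hi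
      simp only [card_filter_eq_one_iff hmono hi', p]
      rcases i with _ | i
      · by_cases c1 : 0 < 2 * n <;> by_cases c2 : a 0 = a (0 + 1) <;> simp [c1, c2]
      · have := hstrict i
        have := hmono i
        have := hmono (i + 1)
        simp only [Nat.add_sub_cancel]
        split_ifs <;> first | omega | grind
  rw [Finset.sum_add_distrib, Finset.sum_add_distrib, ← Finset.card_filter] at h1
  rw [Finset.sum_range_succ (fun i => if i < 2 * n then p i else 0),
    Finset.sum_range_succ' (fun i => if 0 < i then p (i - 1) else 0)] at h1
  have h2 : ∑ i ∈ Finset.range (2 * n), (if i < 2 * n then p i else 0) =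
      ∑ i ∈ Finset.range (2 * n), p i :=
    Finset.sum_congr rfl fun i hi => if_pos (Finset.mem_range.1 hi)
  rw [h2] at h1
  simp only [lt_irrefl, if_false, Nat.succ_pos, if_true, Nat.add_sub_cancel, add_zero] at h1
  have h3 : ∀ m ≤ n, (oddSingles m a).card + ∑ i ∈ Finset.range (2 * m), p i = m := by
    intro m
    induction m with
    | zero => simp [oddSingles]
    | succ m ih =>
      intro hm
      have ih' := ih (by omega)
      have g1 := hmono (2 * m) (by omega)
      have g2 := hmono (2 * m + 1) (by omega)
      have g3 := hstrict (2 * m) (by omega)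
      rw [show 2 * (m + 1) = 2 * m + 1 + 1 by ring, Finset.sum_range_succ, Finset.sum_range_succ]
      unfold oddSingles at ih' ⊢
      rw [Finset.card_filter, Finset.sum_range_succ, ← Finset.card_filter]
      simp only [p] at ih' ⊢
      split_ifs <;> first | omega | grind
  have h4 := h3 n le_rfl
  omega

theorem swapped_eq_of_eq {a : ℕ → ℕ} {n : ℕ} {S : Finset ℕ} (hS : S ⊆ oddSingles n a) {k : ℕ}
    (h : a (2 * k) = a (2 * k + 1)) : swapped a S (k + 1) = swapped a S k := by
  have : k ∉ S := fun hk => (Finset.mem_filter.1 (hS hk)).2.1 h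
  simp [swapped, this, h]

theorem swapped_of_ne {a : ℕ → ℕ} {S : Finset ℕ} {k : ℕ}
    (h : a (2 * k) ≠ a (2 * k + 1)) : swapped a S (k + 1) = decide (k ∈ S) := by
  simp [swapped, h]

theorem split_seqs (a : ℕ → ℕ) (S : Finset ℕ) (k : ℕ) :
    (firstSeq a S (k + 1) = hatSeq a (2 * k + 1) ∧
      secondSeq a S (k + 1) = hatSeq a (2 * k + 2)) ∨
    (firstSeq a S (k + 1) = hatSeq a (2 * k + 2) ∧
      secondSeq a S (k + 1) = hatSeq a (2 * k + 1)) := by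
  by_cases h : swapped a S (k + 1) <;> simp [firstSeq, secondSeq, h]

theorem gap_firstSeq {n : ℕ} {a : ℕ → ℕ}
    (hmono : ∀ i, i + 1 ≤ 2 * n → a i ≤ a (i + 1))
    (hstrict : ∀ i, i + 2 ≤ 2 * n → a i < a (i + 2)) {S : Finset ℕ}
    (hS : S ⊆ oddSingles n a) {k : ℕ} (hk : k < n) :
    firstSeq a S k + 2 ≤ firstSeq a S (k + 1) := by
  have g1 := hmono (2 * k) (by omega)
  have g2 := hstrict (2 * k) (by omega)
  have e0 := hatSeq_two_mul a k
  have e1 := hatSeq_two_mul_add_one a k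
  have e2 := hatSeq_two_mul_add_two a k
  have hE := swapped_eq_of_eq hS (k := k)
  rcases k with _ | k
  · simp only [firstSeq]
    simp only [Nat.mul_zero, Nat.zero_add, swapped] at *
    split_ifs <;> grind
  · have e3 := hatSeq_two_mul_add_one a k
    have g3 := hstrict (2 * k + 1) (by omega)
    have g4 := hmono (2 * k + 1) (by omega)
    simp only [firstSeq]
    simp only [Nat.mul_add, Nat.mul_one, Nat.add_assoc] at *
    norm_num at *
    split_ifs <;> grind

theorem gap_secondSeq {n : ℕ} {a : ℕ → ℕ}
    (hmono : ∀ i, i + 1 ≤ 2 * n → a i ≤ a (i + 1))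
    (hstrict : ∀ i, i + 2 ≤ 2 * n → a i < a (i + 2)) {S : Finset ℕ}
    (hS : S ⊆ oddSingles n a) {k : ℕ} (hk : k + 1 < n) :
    secondSeq a S (k + 1) + 2 ≤ secondSeq a S (k + 2) := by
  have g1 := hmono (2 * k + 2) (by omega)
  have g2 := hstrict (2 * k + 2) (by omega)
  have g3 := hstrict (2 * k + 1) (by omega)
  have g4 := hmono (2 * k + 1) (by omega)
  have e0 := hatSeq_two_mul_add_one a k
  have e1 := hatSeq_two_mul_add_two a k
  have e2 := hatSeq_two_mul_add_one a (k + 1)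
  have e3 := hatSeq_two_mul_add_two a (k + 1)
  have hE := swapped_eq_of_eq hS (k := k + 1)
  simp only [secondSeq]
  simp only [Nat.mul_add, Nat.mul_one, Nat.add_assoc] at *
  norm_num at *
  split_ifs <;> grind

theorem exists_eq_seqs {n : ℕ} {a x y : ℕ → ℕ} (hx0 : x 0 = hatSeq a 0)
    (hsplit : ∀ k < n, (x (k + 1) = hatSeq a (2 * k + 1) ∧ y (k + 1) = hatSeq a (2 * k + 2)) ∨
      (x (k + 1) = hatSeq a (2 * k + 2) ∧ y (k + 1) = hatSeq a (2 * k + 1)))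
    (hx : ∀ k, k < n → x k + 2 ≤ x (k + 1))
    (hy : ∀ k, k + 1 < n → y (k + 1) + 2 ≤ y (k + 2)) :
    ∃ S ⊆ oddSingles n a, (∀ k ≤ n, firstSeq a S k = x k) ∧
      ∀ k < n, secondSeq a S (k + 1) = y (k + 1) := by
  classical
  let S := (oddSingles n a).filter fun k => x (k + 1) = hatSeq a (2 * k + 1)
  have key : ∀ k ≤ n, firstSeq a S k = x k ∧ (0 < k → secondSeq a S k = y k) := by
    intro k
    induction k with
    | zero => intro _; exact ⟨hx0.symm, by simp⟩
    | succ k ih =>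
      intro hk
      obtain ⟨ih1, ih2⟩ := ih (by omega)
      have hs := hsplit k (by omega)
      have e0 := hatSeq_two_mul a k
      have e1 := hatSeq_two_mul_add_one a k
      have e2 := hatSeq_two_mul_add_two a k
      by_cases hO : a (2 * k + 1) = a (2 * k + 2)
      · have := split_seqs a S k
        omega
      by_cases hE : a (2 * k) = a (2 * k + 1)
      · have hw : swapped a S (k + 1) = swapped a S k :=
          swapped_eq_of_eq (Finset.filter_subset _ _) hE
        simp only [firstSeq, secondSeq, hw]
        cases hc : swapped a S k with
        | false =>
          have : x k = hatSeq a (2 * k) := by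
            rw [← ih1]
            rcases k with _ | k
            · rfl
            · simp [firstSeq, hc, Nat.mul_add]
          have := hx k (by omega)
          simp only [Bool.false_eq_true, if_false]
          omega
        | true =>
          rcases k with _ | k
          · simp [swapped] at hc
          have : y (k + 1) = hatSeq a (2 * (k + 1)) := by
            rw [← ih2 (by omega)]
            simp [secondSeq, hc, Nat.mul_add]
          have := hy k (by omega)
          simp only [if_true]
          have e : k + 2 = k + 1 + 1 := rfl
          rw [e] at this
          omega
      · have hw : swapped a S (k + 1) = decide (k ∈ S) := swapped_of_ne hE
        have hF : k ∈ oddSingles n a :=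
          Finset.mem_filter.2 ⟨Finset.mem_range.2 (by omega), hE, hO⟩
        have hkS : k ∈ S ↔ x (k + 1) = hatSeq a (2 * k + 1) := by simp [S, hF]
        simp only [firstSeq, secondSeq, hw, decide_eq_true_eq, hkS]
        split_ifs with hc <;> omega
  refine ⟨S, Finset.filter_subset _ _, fun k hk => (key k hk).1, fun k hk => (key (k + 1) hk).2 ?_⟩
  omega

theorem injOn_pairOfSeqs {n : ℕ} {a : ℕ → ℕ}
    (hmono : ∀ i, i + 1 ≤ 2 * n → a i ≤ a (i + 1))
    (hstrict : ∀ i, i + 2 ≤ 2 * n → a i < a (i + 2)) :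
    Set.InjOn (fun S => pairOfSeqs n (firstSeq a S) (secondSeq a S))
      ((oddSingles n a).powerset : Set (Finset ℕ)) := by
  intro S hS S' hS' h
  rw [Finset.mem_coe, Finset.mem_powerset] at hS hS'
  have inc : ∀ S ⊆ oddSingles n a, ∀ i j, i < j → j < n + 1 → firstSeq a S i < firstSeq a S j := by
    intro S hS i j hij hj
    have := lt_of_gap (m := n + 1)
      (fun k hk => gap_firstSeq hmono hstrict hS (k := k) (by omega)) i j hij hj
    omega
  have hl : (List.range (n + 1)).map (firstSeq a S) = (List.range (n + 1)).map (firstSeq a S') := by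
    rw [← sort_image_range (inc S hS), ← sort_image_range (inc S' hS')]
    exact congrArg (fun A : Finset ℕ => A.sort (· ≤ ·)) (congrArg Prod.fst h)
  have hf : ∀ k ≤ n, firstSeq a S k = firstSeq a S' k := by
    intro k hk
    exact List.map_inj_left.1 hl k (List.mem_range.2 (by omega))
  have hiff : ∀ k ∈ oddSingles n a, (k ∈ S ↔ k ∈ S') := by
    intro k hk
    obtain ⟨hkn, hE, hO⟩ := Finset.mem_filter.1 hk
    have := hf (k + 1) (Finset.mem_range.1 hkn)
    have e1 := hatSeq_two_mul_add_one a k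
    have e2 := hatSeq_two_mul_add_two a k
    simp only [firstSeq, swapped_of_ne hE, decide_eq_true_eq] at this
    split_ifs at this <;> first | tauto | omega
  ext k
  exact ⟨fun hk => (hiff k (hS hk)).1 hk, fun hk => (hiff k (hS' hk)).2 hk⟩

theorem no_consecutive {m : ℕ} {x : ℕ → ℕ} (hx : ∀ i j, i < j → j < m → x i + 2 ≤ x j) :
    ∀ t ∈ (Finset.range m).image x, t + 1 ∉ (Finset.range m).image x := by
  intro t ht ht'
  obtain ⟨i, hi, rfl⟩ := Finset.mem_image.1 ht
  obtain ⟨j, hj, e⟩ := Finset.mem_image.1 ht'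
  rw [Finset.mem_range] at hi hj
  rcases lt_trichotomy i j with h | rfl | h
  · have := hx i j h hj
    omega
  · omega
  · have := hx j i h hi
    omega

/-- Setup §1: the set `T₁` of ordered pairs `(A,B)` of finite
subsets of `ℕ` with `0 ∉ B`, neither containing two consecutive integers,
`|A| = N/2 + 1`, `|B| = N/2`, `A ⊔ B = {â_0,…,â_N}` as multisets (where
`â_i = a_i + ⌈i/2⌉`), and `A⁻ ⊔ B⁻ = {a_0,…,a_N}` as multisets (where
`A⁻ = {x_0, x_1-1, …, x_p-p}` for `A = {x_0 < … < x_p}` and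
`B⁻ = {y_1-1, y_2-2, …, y_q-q}` for `B = {y_1 < … < y_q}`), has exactly `2^M`
elements. -/
theorem stmt_9 (N M : ℕ) (a I : ℕ → ℕ)
    (hN : Even N)
    (hmono : ∀ i, i + 1 ≤ N → a i ≤ a (i + 1))
    (hstrict : ∀ i, i + 2 ≤ N → a i < a (i + 2))
    (hImono : ∀ s t, s < t → t ≤ 2 * M → I s < I t)
    (hIJ : ∀ i, (i ≤ N ∧ ((Finset.range (N + 1)).filter fun j => a j = a i).card = 1)
        ↔ ∃ s, s ≤ 2 * M ∧ I s = i) :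
    Set.ncard {p : Finset ℕ × Finset ℕ |
      0 ∉ p.2
      ∧ (∀ x ∈ p.1, x + 1 ∉ p.1)
      ∧ (∀ x ∈ p.2, x + 1 ∉ p.2)
      ∧ p.1.card = N / 2 + 1
      ∧ p.2.card = N / 2
      ∧ p.1.val + p.2.val = (Multiset.range (N + 1)).map (fun i => a i + (i + 1) / 2)
      ∧ ((((p.1.sort (· ≤ ·)).mapIdx fun k x => x - k : List ℕ) : Multiset ℕ)
          + (((p.2.sort (· ≤ ·)).mapIdx fun k y => y - (k + 1) : List ℕ) : Multiset ℕ))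
          = (Multiset.range (N + 1)).map a}
    = 2 ^ M := by
  obtain ⟨n, rfl⟩ : ∃ n, N = 2 * n := hN.two_dvd
  have hM : (oddSingles n a).card = M := by
    have h1 := card_singles hmono hstrict
    have h2 : ((Finset.range (2 * n + 1)).filter fun i =>
        ((Finset.range (2 * n + 1)).filter fun j => a j = a i).card = 1) =
        (Finset.range (2 * M + 1)).image I := by
      ext i
      have := hIJ i
      simp only [Finset.mem_filter, Finset.mem_image, Finset.mem_range, Nat.lt_succ_iff] at this ⊢
      exact this
    rw [h2, card_image_range fun i j hij hj => hImono i j hij (by omega)] at h1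
    omega
  rw [← hM, ← Finset.card_powerset, ← Set.ncard_coe_finset,
    ← (injOn_pairOfSeqs hmono hstrict).ncard_image]
  congr 1
  rw [Nat.mul_div_cancel_left n two_pos]
  ext ⟨A, B⟩
  simp only [Set.mem_ofPred_eq, Set.mem_image, Finset.mem_coe, Finset.mem_powerset]
  constructor
  · rintro ⟨hB0, hA, hB, hAc, hBc, hhat, hminus⟩
    obtain ⟨x, hxlt, hxA⟩ := exists_enumeration A
    obtain ⟨y', hylt, hyB⟩ := exists_enumeration B
    obtain ⟨y, rfl⟩ : ∃ y : ℕ → ℕ, y' = fun k => y (k + 1) := ⟨fun k => y' (k - 1), by simp⟩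
    rw [hAc] at hxlt hxA
    rw [hBc] at hylt hyB
    subst hxA hyB
    rw [image_range_val hxlt, image_range_val hylt] at hhat
    rw [sort_image_range hxlt, sort_image_range hylt, mapIdx_map_range, mapIdx_map_range] at hminus
    have hx : ∀ k, k < n → x k + 2 ≤ x (k + 1) := by
      intro k hk
      have h1 := hxlt k (k + 1) (by omega) (by omega)
      have h2 := hA (x k) (Finset.mem_image_of_mem _ (Finset.mem_range.2 (by omega)))
      have h3 : x (k + 1) ∈ (Finset.range (n + 1)).image x :=
        Finset.mem_image_of_mem _ (Finset.mem_range.2 (by omega))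
      have h4 : x (k + 1) ≠ x k + 1 := fun e => h2 (e ▸ h3)
      omega
    have hy : ∀ k, k + 1 < n → y (k + 1) + 2 ≤ y (k + 2) := by
      intro k hk
      have h1 : y (k + 1) < y (k + 2) := hylt k (k + 1) (by omega) (by omega)
      have h2 := hB (y (k + 1)) (Finset.mem_image.2 ⟨k, Finset.mem_range.2 (by omega), rfl⟩)
      have h3 : y (k + 2) ∈ (Finset.range n).image fun k => y (k + 1) :=
        Finset.mem_image.2 ⟨k + 1, Finset.mem_range.2 hk, rfl⟩
      have h4 : y (k + 2) ≠ y (k + 1) + 1 := fun e => h2 (e ▸ h3)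
      omega
    have hy0 : 0 < n → 0 < y 1 := by
      intro hn
      refine Nat.pos_of_ne_zero fun e => hB0 ?_
      exact Finset.mem_image.2 ⟨0, Finset.mem_range.2 hn, e⟩
    have hmem : ∀ t, t ∈ (Multiset.range (2 * n + 1)).map a → ∃ i ≤ 2 * n, a i = t := by
      intro t ht
      obtain ⟨i, hi, e⟩ := Multiset.mem_map.1 ht
      exact ⟨i, Nat.lt_succ_iff.1 (Multiset.mem_range.1 hi), e⟩
    have hxa : ∀ k ≤ n, ∃ i ≤ 2 * n, a i = x k - k := by
      intro k hk
      apply hmem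
      rw [← hminus, Multiset.mem_add, Multiset.mem_coe]
      exact Or.inl (List.mem_map.2 ⟨k, List.mem_range.2 (by omega), rfl⟩)
    have hya : ∀ k < n, ∃ i ≤ 2 * n, a i = y (k + 1) - (k + 1) := by
      intro k hk
      apply hmem
      rw [← hminus, Multiset.mem_add, Multiset.mem_coe, Multiset.mem_coe]
      exact Or.inr (List.mem_map.2 ⟨k, List.mem_range.2 (by omega), rfl⟩)
    obtain ⟨hx0, hsplit⟩ := split_pairs hmono hx hy hy0 hxa hya hhat
    obtain ⟨S, hS, hfirst, hsecond⟩ := exists_eq_seqs hx0 hsplit hx hy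
    refine ⟨S, hS, ?_⟩
    refine Prod.ext (Finset.image_congr ?_) (Finset.image_congr ?_)
    · intro k hk
      exact hfirst k (by simpa [Nat.lt_succ_iff] using hk)
    · intro k hk
      exact hsecond k (by simpa using hk)
  · rintro ⟨S, hS, h⟩
    obtain ⟨rfl, rfl⟩ := Prod.ext_iff.1 h
    simp only [pairOfSeqs]
    set x := firstSeq a S with hxdef
    set y := secondSeq a S with hydef
    have hxgap := lt_of_gap (m := n + 1) (x := x)
      (fun k hk => gap_firstSeq hmono hstrict hS (k := k) (by omega))
    have hygap := lt_of_gap (m := n) (x := fun k => y (k + 1))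
      (fun k hk => gap_secondSeq hmono hstrict hS (k := k) hk)
    have hxlt : ∀ i j, i < j → j < n + 1 → x i < x j := by
      intro i j hij hj
      have := hxgap i j hij hj
      omega
    have hylt : ∀ i j, i < j → j < n → y (i + 1) < y (j + 1) := by
      intro i j hij hj
      have := hygap i j hij hj
      omega
    have hsplit := split_seqs a S
    rw [← hxdef, ← hydef] at hsplit
    rw [image_range_val hxlt, image_range_val hylt, sort_image_range hxlt, sort_image_range hylt,
      mapIdx_map_range, mapIdx_map_range, card_image_range hxlt, card_image_range hylt]
    refine ⟨?_, no_consecutive hxgap, no_consecutive hygap, rfl, rfl,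
      map_range_add_map_range (z := hatSeq a) rfl fun k _ => hsplit k, ?_⟩
    · intro h0
      obtain ⟨k, _, e⟩ := Finset.mem_image.1 h0
      have e1 := hatSeq_two_mul_add_one a k
      have e2 := hatSeq_two_mul_add_two a k
      have := hsplit k
      omega
    · refine map_range_add_map_range (x := fun k => x k - k) (y := fun k => y k - k) ?_ ?_
      · exact hatSeq_two_mul a 0
      · intro k _
        have e1 := hatSeq_two_mul_add_one a k
        have e2 := hatSeq_two_mul_add_two a k
        have := hsplit k
        omega
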